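/- arXiv:2208.09879 — 6 statements merged into one kernel-verified Lean document; each statement's English description precedes it below -/
import Mathlib

section
/- Let X and Y be real Banach spaces, γ : X → Y a continuous linear operator, and J = (0,T) a bounded open interval. Let u, w : ℝ → X be Bochner integrable on J such that w is the weak derivative of u on J, i.e. ∫_J φ(s) • w(s) ds = − ∫_J φ'(s) • u(s) ds for every smooth compactly supported test function φ with support in J. If γ(u(s)) = 0 for almost every s ∈ J, then γ(w(s)) = 0 for almost every s ∈ J. -/
open MeasureTheory

/-- A continuous linear map commutes with the integral of an integrable function weighted by a
continuous compactly supported scalar function. -/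
theorem ContinuousLinearMap.integral_smul_comp_of_hasCompactSupport
    {X Y : Type*} [NormedAddCommGroup X] [NormedSpace ℝ X] [CompleteSpace X]
    [NormedAddCommGroup Y] [NormedSpace ℝ Y] [CompleteSpace Y]
    (γ : X →L[ℝ] Y) {μ : Measure ℝ} {f : ℝ → X} (hf : Integrable f μ)
    {φ : ℝ → ℝ} (hφ : Continuous φ) (hφc : HasCompactSupport φ) :
    ∫ s, φ s • γ (f s) ∂μ = γ (∫ s, φ s • f s ∂μ) := by
  simpa using γ.integral_comp_comm
    (hf.locallyIntegrable.integrable_smul_left_of_hasCompactSupport hφ hφc)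

/-- If `w` is the weak derivative of `u` on `J = (0,T)` (Banach-space valued), and the
bounded linear operator `γ` annihilates `u` a.e. on `J`, then `γ` annihilates `w`
a.e. on `J`. (Abstract core of Corollary 2 of the paper, with `γ` the spatial boundary
trace operator.) -/
theorem weak_deriv_vanishes_under_trace
    {X Y : Type*} [NormedAddCommGroup X] [NormedSpace ℝ X] [CompleteSpace X]
    [NormedAddCommGroup Y] [NormedSpace ℝ Y] [CompleteSpace Y]
    (γ : X →L[ℝ] Y) (T : ℝ) (hT : 0 < T)
    (u w : ℝ → X)
    (hu : IntegrableOn u (Set.Ioo 0 T))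
    (hw : IntegrableOn w (Set.Ioo 0 T))
    (hweak : ∀ φ : ℝ → ℝ, ContDiff ℝ (⊤ : ℕ∞) φ → HasCompactSupport φ →
      tsupport φ ⊆ Set.Ioo 0 T →
      ∫ s in Set.Ioo 0 T, φ s • w s = -∫ s in Set.Ioo 0 T, deriv φ s • u s)
    (hγu : ∀ᵐ s ∂(volume.restrict (Set.Ioo 0 T)), γ (u s) = 0) :
    ∀ᵐ s ∂(volume.restrict (Set.Ioo 0 T)), γ (w s) = 0 := by
  rw [ae_restrict_iff' measurableSet_Ioo]
  refine isOpen_Ioo.ae_eq_zero_of_integral_contDiff_smul_eq_zero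
    (IntegrableOn.locallyIntegrableOn (γ.integrable_comp hw)) fun φ hφ hφc hφs => ?_
  have hsupp : ∀ s ∉ Set.Ioo 0 T, φ s • γ (w s) = 0 := fun s hs => by
    rw [image_eq_zero_of_notMem_tsupport fun h => hs (hφs h), zero_smul]
  have hzero : ∫ s in Set.Ioo 0 T, deriv φ s • γ (u s) = 0 :=
    integral_eq_zero_of_ae <| hγu.mono fun s hs => by simp [hs]
  rw [← setIntegral_eq_integral_of_forall_compl_eq_zero hsupp,
    γ.integral_smul_comp_of_hasCompactSupport hw hφ.continuous hφc, hweak φ hφ hφc hφs, map_neg,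
    ← γ.integral_smul_comp_of_hasCompactSupport hu (hφ.continuous_deriv (by simp)) hφc.deriv,
    hzero, neg_zero]
end

section
/- Let H and W be real Hilbert spaces, b : W × W → ℝ a bounded bilinear form with |b(u,v)| ≤ C_b‖u‖‖v‖ which is coercive, b(v,v) ≥ c₀‖v‖² for all v ∈ W with c₀ > 0, c : H × W → ℝ a bounded bilinear form with |c(f,v)| ≤ C_c‖f‖‖v‖, s : W × W → ℝ a bounded symmetric positive semidefinite bilinear form with |s(u,w)| ≤ C_s‖u‖‖w‖, and λ > 0. Then for every pair of continuous linear functionals F on H × W and G on W there exists a unique triple (f,u,y) ∈ H × W × W such that λ⟨f,g⟩_H + s(u,w) + b(w,y) − c(g,y) = F(g,w) for all (g,w) ∈ H × W and b(u,v) − c(f,v) = G(v) for all v ∈ W; moreover ‖f‖_H + ‖u‖_W + ‖y‖_W ≤ C (‖F‖ + ‖G‖), where C depends only on λ, c₀, C_b, C_c, C_s. -/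
open scoped RealInnerProductSpace

section LaxMilgram

variable {V : Type*} [NormedAddCommGroup V] [InnerProductSpace ℝ V] [CompleteSpace V]

/-- Lax–Milgram: a coercive bounded bilinear form has a bounded solution operator. -/
theorem IsCoercive.exists_solutionOperator {B : V →L[ℝ] V →L[ℝ] ℝ} (hB : IsCoercive B) :
    ∃ A : (V →L[ℝ] ℝ) →L[ℝ] V, ∀ L v, B (A L) v = L v := by
  let R : (V →L[ℝ] ℝ) →L[ℝ] V :=
    { toFun := (InnerProductSpace.toDual ℝ V).symm
      map_add' := map_add _
      map_smul' := fun r L => by simp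
      cont := (InnerProductSpace.toDual ℝ V).symm.continuous }
  refine ⟨(hB.continuousLinearEquivOfBilin.symm : V →L[ℝ] V).comp R, fun L v => ?_⟩
  rw [← hB.continuousLinearEquivOfBilin_apply]
  simp only [ContinuousLinearMap.comp_apply, ContinuousLinearEquiv.coe_coe,
    ContinuousLinearEquiv.apply_symm_apply]
  exact InnerProductSpace.toDual_symm_apply

end LaxMilgram

/-- A quadratic-versus-linear inequality for a nonnegative quantity gives a linear bound. -/
theorem le_div_of_mul_sq_le_mul {a x M : ℝ} (ha : 0 < a) (hx : 0 ≤ x) (hM : 0 ≤ M)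
    (h : a * x ^ 2 ≤ M * x) : x ≤ M / a := by
  rw [le_div_iff₀ ha]
  rcases hx.eq_or_lt with rfl | hx
  · simpa using hM
  · exact le_of_mul_le_mul_right (by linarith) hx

section SaddlePoint

variable {H W : Type*} [NormedAddCommGroup H] [InnerProductSpace ℝ H]
  [NormedAddCommGroup W] [InnerProductSpace ℝ W]

/-- The saddle-point system for the triple `(f, u, y)` with data `F`, `G`. -/
def IsSaddlePointSolution (lam : ℝ) (b : W →ₗ[ℝ] W →ₗ[ℝ] ℝ) (c : H →ₗ[ℝ] W →ₗ[ℝ] ℝ)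
    (s : W →ₗ[ℝ] W →ₗ[ℝ] ℝ) (F : (H × W) →L[ℝ] ℝ) (G : W →L[ℝ] ℝ) (p : H × W × W) : Prop :=
  (∀ (g : H) (w : W), lam * ⟪p.1, g⟫ + s p.2.1 w + b w p.2.2 - c g p.2.2 = F (g, w)) ∧
    ∀ v : W, b p.2.1 v - c p.1 v = G v

variable {lam c₀ C_b C_c C_s : ℝ} {b : W →ₗ[ℝ] W →ₗ[ℝ] ℝ} {c : H →ₗ[ℝ] W →ₗ[ℝ] ℝ}
  {s : W →ₗ[ℝ] W →ₗ[ℝ] ℝ}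

theorem IsSaddlePointSolution.sub {F F' : (H × W) →L[ℝ] ℝ} {G G' : W →L[ℝ] ℝ}
    {p q : H × W × W} (hp : IsSaddlePointSolution lam b c s F G p)
    (hq : IsSaddlePointSolution lam b c s F' G' q) :
    IsSaddlePointSolution lam b c s (F - F') (G - G') (p - q) := by
  refine ⟨fun g w => ?_, fun v => ?_⟩
  · simp only [Prod.fst_sub, Prod.snd_sub, inner_sub_left, map_sub, LinearMap.sub_apply,
      _root_.sub_apply, ← hp.1 g w, ← hq.1 g w]
    ring
  · simp only [Prod.fst_sub, Prod.snd_sub, map_sub, LinearMap.sub_apply,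
      _root_.sub_apply, ← hp.2 v, ← hq.2 v]
    ring

variable [CompleteSpace W]

theorem LinearMap.exists_solutionOperator_of_coercive (hc₀ : 0 < c₀)
    (hb : ∀ u v, |b u v| ≤ C_b * ‖u‖ * ‖v‖) (hbc : ∀ v, c₀ * ‖v‖ ^ 2 ≤ b v v) :
    ∃ A : (W →L[ℝ] ℝ) →L[ℝ] W, ∀ L v, b (A L) v = L v :=
  IsCoercive.exists_solutionOperator (B := b.mkContinuous₂ C_b hb)
    ⟨c₀, hc₀, fun u => by simpa [pow_two, mul_assoc] using hbc u⟩

theorem exists_isSaddlePointSolution [CompleteSpace H] (hlam : 0 < lam) (hc₀ : 0 < c₀)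
    (hb : ∀ u v, |b u v| ≤ C_b * ‖u‖ * ‖v‖) (hbc : ∀ v, c₀ * ‖v‖ ^ 2 ≤ b v v)
    (hc : ∀ f v, |c f v| ≤ C_c * ‖f‖ * ‖v‖) (hs : ∀ u v, |s u v| ≤ C_s * ‖u‖ * ‖v‖)
    (hs0 : ∀ v, 0 ≤ s v v) (F : (H × W) →L[ℝ] ℝ) (G : W →L[ℝ] ℝ) :
    ∃ p, IsSaddlePointSolution lam b c s F G p := by
  obtain ⟨A, hA⟩ := LinearMap.exists_solutionOperator_of_coercive hc₀ hb hbc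
  obtain ⟨A', hA'⟩ := LinearMap.exists_solutionOperator_of_coercive (b := b.flip) (C_b := C_b) hc₀
    (fun u v => (hb v u).trans_eq (by ring)) hbc
  simp only [LinearMap.flip_apply] at hA'
  let S : W →L[ℝ] W →L[ℝ] ℝ := s.mkContinuous₂ C_s hs
  have hS : ∀ u v, S u v = s u v := fun _ _ => rfl
  -- The control-to-state map.
  let T : H →L[ℝ] W := A.comp (c.mkContinuous₂ C_c hc)
  have hT : ∀ f v, b (T f) v = c f v := fun f v => hA _ v
  -- The Hessian of the reduced functional.
  let J : H →L[ℝ] H →L[ℝ] ℝ := innerSL ℝ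
  have hJ : ∀ f g, J f g = ⟪f, g⟫ := fun _ _ => rfl
  let M : H →L[ℝ] H →L[ℝ] ℝ := lam • J + S.bilinearComp T T
  have hM : ∀ f g, M f g = lam * ⟪f, g⟫ + s (T f) (T g) := fun f g => by
    simp [M, hS, hJ]
  have hMc : IsCoercive M := ⟨lam, hlam, fun f => by
    rw [hM, real_inner_self_eq_norm_mul_norm]
    linarith [hs0 (T f)]⟩
  obtain ⟨R, hR⟩ := hMc.exists_solutionOperator
  let L : H →L[ℝ] ℝ := F.comp ((ContinuousLinearMap.id ℝ H).prod T) - (S (A G)).comp T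
  have hL : ∀ g, L g = F (g, T g) - s (A G) (T g) := fun g => rfl
  let f := R L
  let u := T f + A G
  let y := A' (F.comp (ContinuousLinearMap.inr ℝ H W) - S u)
  have hy : ∀ w, b w y = F (0, w) - s u w := fun w => hA' _ w
  refine ⟨(f, u, y), fun g w => ?_, fun v => ?_⟩
  · have hf : lam * ⟪f, g⟫ + s (T f) (T g) = F (g, T g) - s (A G) (T g) := by
      rw [← hM, ← hL, hR]
    have hcy : c g y = F (0, T g) - s u (T g) := by rw [← hT, hy]
    have hu : s u (T g) = s (T f) (T g) + s (A G) (T g) := by simp [u]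
    have hF : ∀ w, F (g, w) = F (g, 0) + F (0, w) := fun w => by simp [← map_add]
    change lam * ⟪f, g⟫ + s u w + b w y - c g y = F (g, w)
    rw [hy, hcy, hF w]
    linarith [hF (T g)]
  · change b u v - c f v = G v
    simp [u, hT, hA]

theorem IsSaddlePointSolution.norm_le (hlam : 0 < lam) (hc₀ : 0 < c₀)
    (hC_c : 0 ≤ C_c) (hC_s : 0 ≤ C_s)
    (hb : ∀ u v, |b u v| ≤ C_b * ‖u‖ * ‖v‖) (hbc : ∀ v, c₀ * ‖v‖ ^ 2 ≤ b v v)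
    (hc : ∀ f v, |c f v| ≤ C_c * ‖f‖ * ‖v‖) (hs : ∀ u v, |s u v| ≤ C_s * ‖u‖ * ‖v‖)
    (hs0 : ∀ v, 0 ≤ s v v) {F : (H × W) →L[ℝ] ℝ} {G : W →L[ℝ] ℝ} {p : H × W × W}
    (hp : IsSaddlePointSolution lam b c s F G p) :
    ‖p.1‖ ≤ (‖F‖ * (1 + C_c / c₀) + C_s * (‖G‖ / c₀) * (C_c / c₀)) / lam ∧
      ‖p.2.1‖ ≤ C_c / c₀ * ‖p.1‖ + ‖G‖ / c₀ ∧
      ‖p.2.2‖ ≤ (‖F‖ + C_s * ‖p.2.1‖) / c₀ := by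
  obtain ⟨f, u, y⟩ := p
  obtain ⟨h₁, h₂⟩ := hp
  dsimp only at h₁ h₂ ⊢
  obtain ⟨A, hA⟩ := LinearMap.exists_solutionOperator_of_coercive hc₀ hb hbc
  have hG : ‖A G‖ ≤ ‖G‖ / c₀ :=
    le_div_of_mul_sq_le_mul hc₀ (norm_nonneg _) (norm_nonneg _) <| by
      linarith [hbc (A G), hA G (A G), (le_abs_self _).trans (G.le_opNorm (A G))]
  obtain ⟨w, hw⟩ : ∃ w, w = u - A G := ⟨_, rfl⟩
  have hbw : ∀ v, b w v = c f v := fun v => by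
    rw [hw, map_sub, LinearMap.sub_apply, hA]
    linarith [h₂ v]
  have hw_le : ‖w‖ ≤ C_c / c₀ * ‖f‖ := by
    rw [div_mul_eq_mul_div]
    refine le_div_of_mul_sq_le_mul hc₀ (norm_nonneg _) (by positivity) ?_
    linarith [hbc w, hbw w, (le_abs_self _).trans (hc f w)]
  have hu : u = w + A G := by rw [hw, sub_add_cancel]
  refine ⟨?_, ?_, ?_⟩
  · refine le_div_of_mul_sq_le_mul hlam (norm_nonneg _) (by positivity) ?_
    have hfw : lam * ‖f‖ ^ 2 + (s w w + s (A G) w) = F (f, w) := by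
      rw [← h₁ f w, hbw, real_inner_self_eq_norm_sq, hu, map_add, LinearMap.add_apply]
      ring
    have hF : F (f, w) ≤ ‖F‖ * (‖f‖ + C_c / c₀ * ‖f‖) :=
      calc F (f, w) ≤ ‖F‖ * ‖(f, w)‖ := (le_abs_self _).trans (F.le_opNorm _)
        _ ≤ ‖F‖ * (‖f‖ + ‖w‖) := by
          gcongr
          exact max_le_add_of_nonneg (norm_nonneg _) (norm_nonneg _)
        _ ≤ _ := by gcongr
    have hsw : -s (A G) w ≤ C_s * (‖G‖ / c₀) * (C_c / c₀ * ‖f‖) :=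
      calc -s (A G) w ≤ C_s * ‖A G‖ * ‖w‖ := (neg_le_abs _).trans (hs _ _)
        _ ≤ _ := by gcongr
    linarith [hs0 w]
  · rw [hu]
    exact (norm_add_le _ _).trans (add_le_add hw_le hG)
  · refine le_div_of_mul_sq_le_mul hc₀ (norm_nonneg _) (by positivity) ?_
    have hy : s u y + b y y = F (0, y) := by simpa using h₁ 0 y
    have hF : F (0, y) ≤ ‖F‖ * ‖y‖ := by
      simpa using (le_abs_self _).trans (F.le_opNorm (0, y))
    linarith [hbc y, (neg_le_abs _).trans (hs u y)]

end SaddlePoint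

/-- Well-posedness of the abstract saddle-point formulation of the optimality system
(Theorem 2 of the paper): for every pair of continuous linear functionals `F` on `H × W`
and `G` on `W` there is a unique triple `(f, u, y)` solving the two variational equations,
and its norm is bounded by `C (‖F‖ + ‖G‖)` with `C` depending only on
`λ, c₀, C_b, C_c, C_s`. -/
theorem optimality_system_well_posed
    {H W : Type*}
    [NormedAddCommGroup H] [InnerProductSpace ℝ H] [CompleteSpace H]
    [NormedAddCommGroup W] [InnerProductSpace ℝ W] [CompleteSpace W]
    (lam c₀ C_b C_c C_s : ℝ) (hlam : 0 < lam) (hc₀ : 0 < c₀) :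
    ∃ C : ℝ, 0 < C ∧
      ∀ (b : W →ₗ[ℝ] W →ₗ[ℝ] ℝ) (c : H →ₗ[ℝ] W →ₗ[ℝ] ℝ) (s : W →ₗ[ℝ] W →ₗ[ℝ] ℝ),
        (∀ u v : W, |b u v| ≤ C_b * ‖u‖ * ‖v‖) →
        (∀ v : W, c₀ * ‖v‖ ^ 2 ≤ b v v) →
        (∀ (f : H) (v : W), |c f v| ≤ C_c * ‖f‖ * ‖v‖) →
        (∀ u v : W, |s u v| ≤ C_s * ‖u‖ * ‖v‖) →
        (∀ u v : W, s u v = s v u) →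
        (∀ v : W, 0 ≤ s v v) →
        ∀ (F : (H × W) →L[ℝ] ℝ) (G : W →L[ℝ] ℝ),
          (∃! p : H × W × W,
            (∀ (g : H) (w : W),
              lam * ⟪p.1, g⟫ + s p.2.1 w + b w p.2.2 - c g p.2.2 = F (g, w)) ∧
            (∀ v : W, b p.2.1 v - c p.1 v = G v)) ∧
          (∀ p : H × W × W,
            ((∀ (g : H) (w : W),
              lam * ⟪p.1, g⟫ + s p.2.1 w + b w p.2.2 - c g p.2.2 = F (g, w)) ∧
             (∀ v : W, b p.2.1 v - c p.1 v = G v)) →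
            ‖p.1‖ + ‖p.2.1‖ + ‖p.2.2‖ ≤ C * (‖F‖ + ‖G‖)) := by
  obtain ⟨Kc, hKc⟩ : ∃ K, K = max C_c 0 := ⟨_, rfl⟩
  obtain ⟨Ks, hKs⟩ : ∃ K, K = max C_s 0 := ⟨_, rfl⟩
  have hKc0 : 0 ≤ Kc := hKc ▸ le_max_right _ _
  have hKs0 : 0 ≤ Ks := hKs ▸ le_max_right _ _
  obtain ⟨Cf, hCf⟩ : ∃ K, K = ((1 + Kc / c₀) + Ks * (1 / c₀) * (Kc / c₀)) / lam := ⟨_, rfl⟩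
  obtain ⟨Cu, hCu⟩ : ∃ K, K = Kc / c₀ * Cf + 1 / c₀ := ⟨_, rfl⟩
  obtain ⟨Cy, hCy⟩ : ∃ K, K = (1 + Ks * Cu) / c₀ := ⟨_, rfl⟩
  have hCf0 : 0 < Cf := by rw [hCf]; positivity
  have hCu0 : 0 < Cu := by rw [hCu]; positivity
  have hCy0 : 0 < Cy := by rw [hCy]; positivity
  refine ⟨Cf + Cu + Cy, by positivity, fun b c s hb hbc hc hs _ hs0 F G => ?_⟩
  have hc' : ∀ f v, |c f v| ≤ Kc * ‖f‖ * ‖v‖ := fun f v => (hc f v).trans <| by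
    rw [hKc]; gcongr; exact le_max_left _ _
  have hs' : ∀ u v, |s u v| ≤ Ks * ‖u‖ * ‖v‖ := fun u v => (hs u v).trans <| by
    rw [hKs]; gcongr; exact le_max_left _ _
  have bound : ∀ (F : (H × W) →L[ℝ] ℝ) (G : W →L[ℝ] ℝ) (p : H × W × W),
      IsSaddlePointSolution lam b c s F G p →
      ‖p.1‖ + ‖p.2.1‖ + ‖p.2.2‖ ≤ (Cf + Cu + Cy) * (‖F‖ + ‖G‖) := by
    intro F G p hp
    obtain ⟨hf, hu, hy⟩ := hp.norm_le hlam hc₀ hKc0 hKs0 hb hbc hc' hs' hs0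
    obtain ⟨N, hN⟩ : ∃ N, N = ‖F‖ + ‖G‖ := ⟨_, rfl⟩
    have hFN : ‖F‖ ≤ N := by linarith [norm_nonneg G]
    have hGN : ‖G‖ ≤ N := by linarith [norm_nonneg F]
    have hf' : ‖p.1‖ ≤ Cf * N :=
      calc _ ≤ (N * (1 + Kc / c₀) + Ks * (N / c₀) * (Kc / c₀)) / lam := hf.trans (by gcongr)
        _ = Cf * N := by rw [hCf]; ring
    have hu' : ‖p.2.1‖ ≤ Cu * N :=
      calc _ ≤ Kc / c₀ * (Cf * N) + N / c₀ := hu.trans (by gcongr)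
        _ = Cu * N := by rw [hCu]; ring
    have hy' : ‖p.2.2‖ ≤ Cy * N :=
      calc _ ≤ (N + Ks * (Cu * N)) / c₀ := hy.trans (by gcongr)
        _ = Cy * N := by rw [hCy]; ring
    rw [← hN]
    linarith
  obtain ⟨p, hp⟩ := exists_isSaddlePointSolution hlam hc₀ hb hbc hc hs hs0 F G
  refine ⟨⟨p, hp, fun q hq => ?_⟩, bound F G⟩
  have h := bound _ _ _ (IsSaddlePointSolution.sub hq hp)
  simp only [sub_self, ContinuousLinearMap.opNorm_zero, add_zero, mul_zero] at h
  have h₁ := norm_nonneg (q - p).1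
  have h₂ := norm_nonneg (q - p).2.1
  have h₃ := norm_nonneg (q - p).2.2
  refine sub_eq_zero.1 (Prod.ext (norm_eq_zero.1 ?_) (Prod.ext (norm_eq_zero.1 ?_)
    (norm_eq_zero.1 ?_))) <;> linarith
end

section
/- Let H and W be real Hilbert spaces, b : W × W → ℝ a bilinear form that is coercive, b(v,v) ≥ c₀‖v‖² for all v ∈ W with c₀ > 0, c : H × W → ℝ a bounded bilinear form with |c(f,v)| ≤ C_c‖f‖‖v‖, s : W × W → ℝ a positive semidefinite bilinear form, and λ > 0. Define a((f,u),(g,w)) := λ⟨f,g⟩_H + s(u,w). If (f,u) ∈ H × W satisfies b(u,v) = c(f,v) for all v ∈ W, then ‖u‖_W² + ‖f‖_H² ≤ λ^{-1}(1 + (C_c/c₀)²) · a((f,u),(f,u)); in particular a is coercive on the kernel of the constraint form. -/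
open scoped RealInnerProductSpace

/-- Kernel coercivity of `a((f,u),(g,w)) = λ⟨f,g⟩ + s(u,w)` from the proof of Theorem 2
of the paper: if `(f,u)` lies in the kernel of the constraint form, i.e.
`b(u,v) = c(f,v)` for all `v`, then
`‖u‖² + ‖f‖² ≤ λ⁻¹ (1 + (C_c/c₀)²) a((f,u),(f,u))`. -/
theorem kernel_coercivity
    {H W : Type*}
    [NormedAddCommGroup H] [InnerProductSpace ℝ H] [CompleteSpace H]
    [NormedAddCommGroup W] [InnerProductSpace ℝ W] [CompleteSpace W]
    (lam c₀ C_c : ℝ) (hlam : 0 < lam) (hc₀ : 0 < c₀)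
    (b : W →ₗ[ℝ] W →ₗ[ℝ] ℝ) (c : H →ₗ[ℝ] W →ₗ[ℝ] ℝ) (s : W →ₗ[ℝ] W →ₗ[ℝ] ℝ)
    (hcoer : ∀ v : W, c₀ * ‖v‖ ^ 2 ≤ b v v)
    (hcbdd : ∀ (f : H) (v : W), |c f v| ≤ C_c * ‖f‖ * ‖v‖)
    (hspsd : ∀ v : W, 0 ≤ s v v)
    (f : H) (u : W)
    (hker : ∀ v : W, b u v = c f v) :
    ‖u‖ ^ 2 + ‖f‖ ^ 2 ≤ lam⁻¹ * (1 + (C_c / c₀) ^ 2) * (lam * ⟪f, f⟫ + s u u) := by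
  have hu : ‖u‖ ^ 2 ≤ (C_c / c₀) ^ 2 * ‖f‖ ^ 2 := by
    rcases (norm_nonneg u).eq_or_lt with h | h
    · rw [← h, zero_pow two_ne_zero]
      positivity
    · have hquad : c₀ * ‖u‖ * ‖u‖ ≤ C_c * ‖f‖ * ‖u‖ :=
        calc c₀ * ‖u‖ * ‖u‖ = c₀ * ‖u‖ ^ 2 := by ring
          _ ≤ b u u := hcoer u
          _ = c f u := hker u
          _ ≤ C_c * ‖f‖ * ‖u‖ := (le_abs_self _).trans (hcbdd f u)
      have hlin : ‖u‖ ≤ C_c / c₀ * ‖f‖ := by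
        rw [div_mul_eq_mul_div, le_div_iff₀ hc₀, mul_comm]
        exact le_of_mul_le_mul_right hquad h
      rw [← mul_pow]
      exact pow_le_pow_left₀ h.le hlin 2
  calc ‖u‖ ^ 2 + ‖f‖ ^ 2 ≤ (1 + (C_c / c₀) ^ 2) * ‖f‖ ^ 2 := by linarith
    _ = lam⁻¹ * (1 + (C_c / c₀) ^ 2) * (lam * ⟪f, f⟫) := by
      rw [real_inner_self_eq_norm_sq]
      field_simp
    _ ≤ lam⁻¹ * (1 + (C_c / c₀) ^ 2) * (lam * ⟪f, f⟫ + s u u) := by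
      gcongr
      exact le_add_of_nonneg_right (hspsd u)
end

section
/- Let H and W be real Hilbert spaces, b : W × W → ℝ a bounded bilinear form with |b(u,v)| ≤ C_b‖u‖‖v‖ which is coercive, b(v,v) ≥ c₀‖v‖² with c₀ > 0, c : H × W → ℝ a bounded bilinear form with |c(f,v)| ≤ C_c‖f‖‖v‖, s : W × W → ℝ a bounded symmetric positive semidefinite bilinear form with |s(u,w)| ≤ C_s‖u‖‖w‖, and λ > 0. Let F and G be continuous linear functionals on H × W and W respectively, and let H_h ⊆ H and W_h ⊆ W be closed subspaces. Then there exists a unique triple (f_h,u_h,y_h) ∈ H_h × W_h × W_h such that λ⟨f_h,g⟩_H + s(u_h,w) + b(w,y_h) − c(g,y_h) = F(g,w) for all (g,w) ∈ H_h × W_h and b(u_h,v) − c(f_h,v) = G(v) for all v ∈ W_h; moreover ‖f_h‖ + ‖u_h‖ + ‖y_h‖ ≤ C (‖F‖ + ‖G‖), where C depends only on λ, c₀, C_b, C_c, C_s and is independent of the subspaces H_h and W_h. -/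
open scoped RealInnerProductSpace

/-- Lax–Milgram: a coercive bounded bilinear form has a bounded solution operator. -/
theorem IsCoercive.exists_solution_operator {V : Type*} [NormedAddCommGroup V]
    [InnerProductSpace ℝ V] [CompleteSpace V] {B : V →L[ℝ] V →L[ℝ] ℝ} (hB : IsCoercive B) :
    ∃ T : (V →L[ℝ] ℝ) →L[ℝ] V, ∀ l v, B (T l) v = l v := by
  let D : (V →L[ℝ] ℝ) ≃L[ℝ] V := (InnerProductSpace.toDual ℝ V).symm.toContinuousLinearEquiv
  let E := hB.continuousLinearEquivOfBilin.symm
  refine ⟨(E : V →L[ℝ] V) ∘L (D : (V →L[ℝ] ℝ) →L[ℝ] V), fun l v => ?_⟩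
  rw [← hB.continuousLinearEquivOfBilin_apply]
  simp [E, D]

/-- Existence for the saddle-point system, by eliminating the state `u` and the adjoint
state `y` and solving the reduced coercive problem for the control `f`. -/
theorem exists_saddle_point_solution {X Y : Type*}
    [NormedAddCommGroup X] [InnerProductSpace ℝ X] [CompleteSpace X]
    [NormedAddCommGroup Y] [InnerProductSpace ℝ Y] [CompleteSpace Y]
    {lam : ℝ} (hlam : 0 < lam) {b s : Y →L[ℝ] Y →L[ℝ] ℝ} (c : X →L[ℝ] Y →L[ℝ] ℝ)
    (hb : IsCoercive b) (hs : ∀ v, 0 ≤ s v v)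
    (F : (X × Y) →L[ℝ] ℝ) (G : Y →L[ℝ] ℝ) :
    ∃ (f : X) (u y : Y),
      (∀ g w, lam * ⟪f, g⟫ + s u w + b w y - c g y = F (g, w)) ∧
      ∀ v, b u v - c f v = G v := by
  obtain ⟨T, hT⟩ := hb.exists_solution_operator
  have hb' : IsCoercive b.flip := by
    obtain ⟨k, hk, h⟩ := hb
    exact ⟨k, hk, fun u => by simpa using h u⟩
  obtain ⟨T', hT'⟩ := hb'.exists_solution_operator
  let S : X →L[ℝ] Y := T ∘L c
  have hS : ∀ g v, b (S g) v = c g v := fun g v => hT (c g) v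
  let I : X →L[ℝ] X →L[ℝ] ℝ := innerSL ℝ
  let A : X →L[ℝ] X →L[ℝ] ℝ := lam • I + s.bilinearComp S S
  have hA_apply : ∀ f g, A f g = lam * ⟪f, g⟫ + s (S f) (S g) := fun _ _ => rfl
  have hA : IsCoercive A := by
    refine ⟨lam, hlam, fun f => ?_⟩
    rw [hA_apply, real_inner_self_eq_norm_mul_norm]
    linarith [hs (S f)]
  obtain ⟨R, hR⟩ := hA.exists_solution_operator
  let f := R (F ∘L (ContinuousLinearMap.id ℝ X).prod S - s (T G) ∘L S)
  have hf : ∀ g, lam * ⟪f, g⟫ + s (S f) (S g) = F (g, S g) - s (T G) (S g) := fun g => by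
    rw [← hA_apply, hR]
    simp
  let u := S f + T G
  let y := T' (F ∘L ContinuousLinearMap.inr ℝ X Y - s u)
  have hy : ∀ w, b w y = F (0, w) - s u w := fun w => by
    rw [← ContinuousLinearMap.flip_apply, hT']
    simp
  refine ⟨f, u, y, fun g w => ?_, fun v => ?_⟩
  · have hF : ∀ w, F (g, w) = F (g, 0) + F (0, w) := fun w => by simp [← map_add]
    have hu : s u (S g) = s (S f) (S g) + s (T G) (S g) := by simp [u]
    have hfg := hf g
    rw [hF] at hfg ⊢
    rw [← hS, hy, hy, hu]
    linarith
  · simp [u, hS, hT]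

/-- A quadratic inequality `lam * x² ≤ M * (k₁ * x + k₂ * M)` bounds `x` linearly in `M`. -/
theorem le_mul_of_mul_sq_le {lam k₁ k₂ x M : ℝ} (hlam : 0 < lam) (hk₁ : 0 ≤ k₁) (hk₂ : 0 ≤ k₂)
    (hM : 0 ≤ M) (h : lam * x ^ 2 ≤ M * (k₁ * x + k₂ * M)) :
    x ≤ (1 + (k₁ + k₂) / lam) * M := by
  have hq : 0 ≤ (k₁ + k₂) / lam * M := by positivity
  rcases le_total x M with hx | hx
  · linarith
  rcases (hM.trans hx).eq_or_lt with hx0 | hx0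
  · nlinarith
  have h₁ : x * (lam * x) ≤ x * ((k₁ + k₂) * M) := by
    nlinarith [mul_le_mul_of_nonneg_left hx (mul_nonneg hk₂ hM)]
  have h₂ : x ≤ (k₁ + k₂) / lam * M := by
    rw [div_mul_eq_mul_div, le_div_iff₀ hlam]
    linarith [le_of_mul_le_mul_left h₁ hx0]
  linarith

/-- If `k * x² ≤ r * x` with `k > 0` and `r, x ≥ 0`, then `x ≤ r / k`. -/
theorem le_div_of_mul_sq_le {k r x : ℝ} (hk : 0 < k) (hr : 0 ≤ r) (hx : 0 ≤ x)
    (h : k * x ^ 2 ≤ r * x) : x ≤ r / k := by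
  rcases hx.eq_or_lt with rfl | hx
  · positivity
  rw [le_div_iff₀ hk]
  exact le_of_mul_le_mul_right (by linarith) hx

/-- Stability of the saddle-point system on subspaces, with a constant depending only on the
data of the forms. -/
theorem saddle_point_stability {H W : Type*}
    [NormedAddCommGroup H] [InnerProductSpace ℝ H] [NormedAddCommGroup W] [NormedSpace ℝ W]
    {lam c₀ C_c C_s : ℝ} (hlam : 0 < lam) (hc₀ : 0 < c₀) (hCc : 0 ≤ C_c) (hCs : 0 ≤ C_s)
    {k₁ k₂ : ℝ} (hk₁ : k₁ = 1 + C_c / c₀ + C_s * C_c / c₀ ^ 2)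
    (hk₂ : k₂ = 2 / c₀ + C_s / c₀ ^ 2)
    {b s : W →ₗ[ℝ] W →ₗ[ℝ] ℝ} {c : H →ₗ[ℝ] W →ₗ[ℝ] ℝ}
    (hb : ∀ v, c₀ * ‖v‖ ^ 2 ≤ b v v) (hc : ∀ f v, |c f v| ≤ C_c * ‖f‖ * ‖v‖)
    (hs : ∀ u v, |s u v| ≤ C_s * ‖u‖ * ‖v‖) (hs₀ : ∀ v, 0 ≤ s v v)
    {F : (H × W) →L[ℝ] ℝ} {G : W →L[ℝ] ℝ} {Hh : Submodule ℝ H} {Wh : Submodule ℝ W}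
    {f : H} {u y : W} (hf : f ∈ Hh) (hu : u ∈ Wh) (hy : y ∈ Wh)
    (h₁ : ∀ g ∈ Hh, ∀ w ∈ Wh, lam * ⟪f, g⟫ + s u w + b w y - c g y = F (g, w))
    (h₂ : ∀ v ∈ Wh, b u v - c f v = G v) :
    ‖f‖ + ‖u‖ + ‖y‖ ≤ (k₁ * (1 + (k₁ + k₂) / lam) + k₂) * (‖F‖ + ‖G‖) := by
  set M := ‖F‖ + ‖G‖ with hM
  have hk₁' : 0 ≤ k₁ := by rw [hk₁]; positivity
  have hk₂' : 0 ≤ k₂ := by rw [hk₂]; positivity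
  have hM₀ : 0 ≤ M := by positivity
  have hFM : ‖F‖ ≤ M := by linarith [norm_nonneg G]
  have hGM : ‖G‖ ≤ M := by linarith [norm_nonneg F]
  have hG : ∀ v, |G v| ≤ M * ‖v‖ := fun v => G.le_of_opNorm_le hGM v
  have hF : ∀ p, |F p| ≤ M * ‖p‖ := fun p => F.le_of_opNorm_le hFM p
  have hub : ‖u‖ ≤ (M + C_c * ‖f‖) / c₀ := by
    refine le_div_of_mul_sq_le hc₀ (by positivity) (norm_nonneg _) ?_
    have := h₂ u hu
    linarith [hb u, (abs_le.1 (hG u)).2, (abs_le.1 (hc f u)).2]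
  have hyb : ‖y‖ ≤ (M + C_s * ‖u‖) / c₀ := by
    refine le_div_of_mul_sq_le hc₀ (by positivity) (norm_nonneg _) ?_
    have := h₁ 0 Hh.zero_mem y hy
    have hn : ‖((0 : H), y)‖ = ‖y‖ := by simp [Prod.norm_def]
    have hFy := (abs_le.1 (hF (0, y))).2
    rw [hn] at hFy
    simp only [inner_zero_right, mul_zero, map_zero, LinearMap.zero_apply] at this
    linarith [hb y, (abs_le.1 (hs u y)).1]
  have hsum : ‖f‖ + ‖u‖ + ‖y‖ ≤ k₁ * ‖f‖ + k₂ * M := by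
    have : ‖y‖ ≤ (M + C_s * ((M + C_c * ‖f‖) / c₀)) / c₀ := hyb.trans (by gcongr)
    calc ‖f‖ + ‖u‖ + ‖y‖
        ≤ ‖f‖ + (M + C_c * ‖f‖) / c₀ + (M + C_s * ((M + C_c * ‖f‖) / c₀)) / c₀ := by gcongr
      _ = k₁ * ‖f‖ + k₂ * M := by rw [hk₁, hk₂]; field_simp; ring
  have hquad : lam * ‖f‖ ^ 2 ≤ M * (k₁ * ‖f‖ + k₂ * M) := by
    have e₁ := h₁ f hf u hu
    have e₂ := h₂ y hy
    rw [real_inner_self_eq_norm_sq] at e₁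
    have hn : ‖(f, u)‖ ≤ ‖f‖ + ‖u‖ :=
      max_le_add_of_nonneg (norm_nonneg f) (norm_nonneg u)
    have hFfu := (abs_le.1 (hF (f, u))).2.trans (mul_le_mul_of_nonneg_left hn hM₀)
    linarith [hs₀ u, (abs_le.1 (hG y)).1, mul_le_mul_of_nonneg_left hsum hM₀]
  have hfb := mul_le_mul_of_nonneg_left
    (le_mul_of_mul_sq_le hlam hk₁' hk₂' hM₀ hquad) hk₁'
  linarith

/-- Discrete well-posedness and uniform stability (first part of Theorem 4 of the
paper): for arbitrary closed subspaces `H_h ⊆ H`, `W_h ⊆ W` the Galerkin discretization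
of the optimality system has a unique solution, whose norm is bounded by
`C (‖F‖ + ‖G‖)` with `C` depending only on `λ, c₀, C_b, C_c, C_s` and independent of
the subspaces. -/
theorem discrete_optimality_system_well_posed
    {H W : Type*}
    [NormedAddCommGroup H] [InnerProductSpace ℝ H] [CompleteSpace H]
    [NormedAddCommGroup W] [InnerProductSpace ℝ W] [CompleteSpace W]
    (lam c₀ C_b C_c C_s : ℝ) (hlam : 0 < lam) (hc₀ : 0 < c₀) :
    ∃ C : ℝ, 0 < C ∧
      ∀ (b : W →ₗ[ℝ] W →ₗ[ℝ] ℝ) (c : H →ₗ[ℝ] W →ₗ[ℝ] ℝ) (s : W →ₗ[ℝ] W →ₗ[ℝ] ℝ),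
        (∀ u v : W, |b u v| ≤ C_b * ‖u‖ * ‖v‖) →
        (∀ v : W, c₀ * ‖v‖ ^ 2 ≤ b v v) →
        (∀ (f : H) (v : W), |c f v| ≤ C_c * ‖f‖ * ‖v‖) →
        (∀ u v : W, |s u v| ≤ C_s * ‖u‖ * ‖v‖) →
        (∀ u v : W, s u v = s v u) →
        (∀ v : W, 0 ≤ s v v) →
        ∀ (F : (H × W) →L[ℝ] ℝ) (G : W →L[ℝ] ℝ)
          (Hh : Submodule ℝ H) (Wh : Submodule ℝ W),
          IsClosed (Hh : Set H) → IsClosed (Wh : Set W) →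
          (∃! p : H × W × W,
            p.1 ∈ Hh ∧ p.2.1 ∈ Wh ∧ p.2.2 ∈ Wh ∧
            (∀ g ∈ Hh, ∀ w ∈ Wh,
              lam * ⟪p.1, g⟫ + s p.2.1 w + b w p.2.2 - c g p.2.2 = F (g, w)) ∧
            (∀ v ∈ Wh, b p.2.1 v - c p.1 v = G v)) ∧
          (∀ p : H × W × W,
            p.1 ∈ Hh → p.2.1 ∈ Wh → p.2.2 ∈ Wh →
            (∀ g ∈ Hh, ∀ w ∈ Wh,
              lam * ⟪p.1, g⟫ + s p.2.1 w + b w p.2.2 - c g p.2.2 = F (g, w)) →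
            (∀ v ∈ Wh, b p.2.1 v - c p.1 v = G v) →
            ‖p.1‖ + ‖p.2.1‖ + ‖p.2.2‖ ≤ C * (‖F‖ + ‖G‖)) := by
  obtain ⟨k₁, hk₁⟩ : ∃ k, k = 1 + |C_c| / c₀ + |C_s| * |C_c| / c₀ ^ 2 := ⟨_, rfl⟩
  obtain ⟨k₂, hk₂⟩ : ∃ k, k = 2 / c₀ + |C_s| / c₀ ^ 2 := ⟨_, rfl⟩
  have hk₁' : 0 < k₁ := by rw [hk₁]; positivity
  have hk₂' : 0 < k₂ := by rw [hk₂]; positivity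
  refine ⟨k₁ * (1 + (k₁ + k₂) / lam) + k₂, by positivity, ?_⟩
  intro b c s hb hb₀ hc hs _ hs₀ F G Hh Wh hHh hWh
  have hc' : ∀ f v, |c f v| ≤ |C_c| * ‖f‖ * ‖v‖ := fun f v =>
    (hc f v).trans (by gcongr; exact le_abs_self _)
  have hs' : ∀ u v, |s u v| ≤ |C_s| * ‖u‖ * ‖v‖ := fun u v =>
    (hs u v).trans (by gcongr; exact le_abs_self _)
  refine ⟨?_, fun p hf hu hy h₁ h₂ => saddle_point_stability hlam hc₀ (abs_nonneg _)
    (abs_nonneg _) hk₁ hk₂ hb₀ hc' hs' hs₀ hf hu hy h₁ h₂⟩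
  have := hHh.completeSpace_coe
  have := hWh.completeSpace_coe
  refine existsUnique_of_exists_of_unique ?_ ?_
  · let bh := (b.mkContinuous₂ C_b hb).bilinearComp Wh.subtypeL Wh.subtypeL
    let sh := (s.mkContinuous₂ C_s hs).bilinearComp Wh.subtypeL Wh.subtypeL
    let ch := (c.mkContinuous₂ C_c hc).bilinearComp Hh.subtypeL Wh.subtypeL
    have hbh : IsCoercive bh := ⟨c₀, hc₀, fun v => by
      have := hb₀ v
      rw [pow_two, ← mul_assoc] at this
      exact this⟩
    obtain ⟨f, u, y, h₁, h₂⟩ := exists_saddle_point_solution hlam (s := sh) ch hbh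
      (fun v => hs₀ v) (F ∘L Hh.subtypeL.prodMap Wh.subtypeL) (G ∘L Wh.subtypeL)
    exact ⟨(f, u, y), f.2, u.2, y.2, fun g hg w hw => h₁ ⟨g, hg⟩ ⟨w, hw⟩,
      fun v hv => h₂ ⟨v, hv⟩⟩
  · rintro ⟨f, u, y⟩ ⟨f', u', y'⟩ ⟨hf, hu, hy, h₁, h₂⟩ ⟨hf', hu', hy', h₁', h₂'⟩
    dsimp only at *
    have key := saddle_point_stability hlam hc₀ (abs_nonneg _) (abs_nonneg _) hk₁ hk₂ hb₀ hc' hs'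
      hs₀ (F := 0) (G := 0) (Hh.sub_mem hf hf') (Wh.sub_mem hu hu') (Wh.sub_mem hy hy')
      (fun g hg w hw => by
        simp only [inner_sub_left, map_sub, LinearMap.sub_apply, zero_apply]
        linarith [h₁ g hg w hw, h₁' g hg w hw])
      (fun v hv => by
        simp only [map_sub, LinearMap.sub_apply, zero_apply]
        linarith [h₂ v hv, h₂' v hv])
    rw [ContinuousLinearMap.opNorm_zero, ContinuousLinearMap.opNorm_zero, add_zero,
      mul_zero] at key
    have nf := norm_nonneg (f - f')
    have nu := norm_nonneg (u - u')
    have ny := norm_nonneg (y - y')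
    have ef : f = f' := sub_eq_zero.1 (norm_eq_zero.1 (by linarith))
    have eu : u = u' := sub_eq_zero.1 (norm_eq_zero.1 (by linarith))
    have ey : y = y' := sub_eq_zero.1 (norm_eq_zero.1 (by linarith))
    rw [ef, eu, ey]
end

section
/- Let H and W be real Hilbert spaces, b : W × W → ℝ a bounded bilinear form with |b(u,v)| ≤ C_b‖u‖‖v‖ which is coercive, b(v,v) ≥ c₀‖v‖² with c₀ > 0, c : H × W → ℝ a bounded bilinear form with |c(f,v)| ≤ C_c‖f‖‖v‖, s : W × W → ℝ a bounded symmetric positive semidefinite bilinear form with |s(u,w)| ≤ C_s‖u‖‖w‖, and λ > 0. Let F and G be continuous linear functionals, let (f,u,y) ∈ H × W × W solve the system λ⟨f,g⟩_H + s(u,w) + b(w,y) − c(g,y) = F(g,w) for all (g,w) ∈ H × W and b(u,v) − c(f,v) = G(v) for all v ∈ W, and let (f_h,u_h,y_h) ∈ H_h × W_h × W_h solve the same system with test functions restricted to closed subspaces H_h ⊆ H and W_h ⊆ W. Then the quasi-optimality estimate holds: ‖f−f_h‖ + ‖u−u_h‖ + ‖y−y_h‖ ≤ C inf over (f̃,ũ,ỹ)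 ∈ H_h × W_h × W_h of (‖f−f̃‖ + ‖u−ũ‖ + ‖y−ỹ‖), where C depends only on λ, c₀, C_b, C_c, C_s and is independent of the subspaces. -/
open scoped RealInnerProductSpace

/-- The constant `1 + 2 M + M²` with `M = K / c₀` in the bound of all error components by the
control component. -/
noncomputable def stateAdjointConst (K c₀ : ℝ) : ℝ := 1 + 2 * (K / c₀) + (K / c₀) ^ 2

theorem stateAdjointConst_pos {K c₀ : ℝ} (hK : 0 ≤ K) (hc₀ : 0 < c₀) :
    0 < stateAdjointConst K c₀ := by
  unfold stateAdjointConst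
  positivity

/-- If `c t² ≤ k t` with `c > 0` and `k, t ≥ 0`, then `t ≤ k / c`. -/
theorem le_div_of_mul_sq_le_mul_s7 {c t k : ℝ} (hc : 0 < c) (ht : 0 ≤ t) (hk : 0 ≤ k)
    (h : c * t ^ 2 ≤ k * t) : t ≤ k / c := by
  rw [le_div_iff₀ hc]
  rcases ht.eq_or_lt with rfl | ht
  · simpa using hk
  · exact le_of_mul_le_mul_right (by linarith) ht

/-- A real `p` with `p² ≤ d e (p + e)` is at most `(d + 1) e`. -/
theorem le_of_sq_le_mul_add {d e p : ℝ} (hd : 0 ≤ d) (he : 0 ≤ e)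
    (h : p ^ 2 ≤ d * e * (p + e)) : p ≤ (d + 1) * e := by
  by_contra! hlt
  have hde : 0 ≤ d * e := mul_nonneg hd he
  have hppos : 0 < p := lt_of_le_of_lt (by positivity) hlt
  have h₁ : (d + 1) * e * p < p * p := mul_lt_mul_of_pos_right hlt hppos
  have h₂ : e * ((d + 1) * e) ≤ e * p := mul_le_mul_of_nonneg_left hlt.le he
  nlinarith [mul_nonneg he he]

/-- The a priori estimate for a saddle-point system, reduced to the norms `p`, `q`, `r` of the
control, state and adjoint components and the size `e` of the data. -/
theorem add_le_of_saddlePoint_bounds {lam c₀ K e p q r : ℝ} (hlam : 0 < lam) (hc₀ : 0 < c₀)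
    (hK : 0 ≤ K) (he : 0 ≤ e) (hp : 0 ≤ p) (hq : 0 ≤ q) (hr : 0 ≤ r)
    (hstate : c₀ * q ^ 2 ≤ K * (p + e) * q) (hadj : c₀ * r ^ 2 ≤ K * (e + q) * r)
    (henergy : lam * p ^ 2 ≤ K * e * (p + q + r)) :
    p + q + r ≤
      stateAdjointConst K c₀ * (K * stateAdjointConst K c₀ / lam + 2) * e := by
  have hA := stateAdjointConst_pos hK hc₀
  have hM : 0 ≤ K / c₀ := by positivity
  have hq' : q ≤ K / c₀ * (p + e) := by
    have := le_div_of_mul_sq_le_mul_s7 hc₀ hq (by positivity) hstate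
    rwa [mul_div_right_comm] at this
  have hr' : r ≤ K / c₀ * (e + q) := by
    have := le_div_of_mul_sq_le_mul_s7 hc₀ hr (by positivity) hadj
    rwa [mul_div_right_comm] at this
  have hsum : p + q + r ≤ stateAdjointConst K c₀ * (p + e) := by
    have := mul_le_mul_of_nonneg_left hq' hM
    unfold stateAdjointConst
    nlinarith [mul_nonneg hM hp]
  have hp' : p ≤ (K * stateAdjointConst K c₀ / lam + 1) * e := by
    refine le_of_sq_le_mul_add (by positivity) he ?_
    have := henergy.trans (mul_le_mul_of_nonneg_left hsum (mul_nonneg hK he))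
    rw [div_mul_eq_mul_div, div_mul_eq_mul_div, le_div_iff₀ hlam]
    linarith
  calc p + q + r ≤ stateAdjointConst K c₀ * (p + e) := hsum
    _ ≤ stateAdjointConst K c₀ * ((K * stateAdjointConst K c₀ / lam + 1) * e + e) := by gcongr
    _ = _ := by ring

/-- Quasi-optimality of the Galerkin discretization of the optimality system (second
part of Theorem 4 of the paper): the error of the discrete solution is bounded by a
constant times the best-approximation error from the subspaces, with the constant
depending only on `λ, c₀, C_b, C_c, C_s` and independent of the subspaces. -/
theorem discrete_optimality_system_quasi_optimal
    {H W : Type*}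
    [NormedAddCommGroup H] [InnerProductSpace ℝ H] [CompleteSpace H]
    [NormedAddCommGroup W] [InnerProductSpace ℝ W] [CompleteSpace W]
    (lam c₀ C_b C_c C_s : ℝ) (hlam : 0 < lam) (hc₀ : 0 < c₀) :
    ∃ C : ℝ, 0 < C ∧
      ∀ (b : W →ₗ[ℝ] W →ₗ[ℝ] ℝ) (c : H →ₗ[ℝ] W →ₗ[ℝ] ℝ) (s : W →ₗ[ℝ] W →ₗ[ℝ] ℝ),
        (∀ u v : W, |b u v| ≤ C_b * ‖u‖ * ‖v‖) →
        (∀ v : W, c₀ * ‖v‖ ^ 2 ≤ b v v) →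
        (∀ (f : H) (v : W), |c f v| ≤ C_c * ‖f‖ * ‖v‖) →
        (∀ u v : W, |s u v| ≤ C_s * ‖u‖ * ‖v‖) →
        (∀ u v : W, s u v = s v u) →
        (∀ v : W, 0 ≤ s v v) →
        ∀ (F : (H × W) →L[ℝ] ℝ) (G : W →L[ℝ] ℝ)
          (f : H) (u y : W),
          (∀ (g : H) (w : W),
            lam * ⟪f, g⟫ + s u w + b w y - c g y = F (g, w)) →
          (∀ v : W, b u v - c f v = G v) →
          ∀ (Hh : Submodule ℝ H) (Wh : Submodule ℝ W),
            IsClosed (Hh : Set H) → IsClosed (Wh : Set W) →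
            ∀ (f_h : H) (u_h y_h : W),
              f_h ∈ Hh → u_h ∈ Wh → y_h ∈ Wh →
              (∀ g ∈ Hh, ∀ w ∈ Wh,
                lam * ⟪f_h, g⟫ + s u_h w + b w y_h - c g y_h = F (g, w)) →
              (∀ v ∈ Wh, b u_h v - c f_h v = G v) →
              ∀ ft ∈ Hh, ∀ ut ∈ Wh, ∀ yt ∈ Wh,
                ‖f - f_h‖ + ‖u - u_h‖ + ‖y - y_h‖ ≤
                  C * (‖f - ft‖ + ‖u - ut‖ + ‖y - yt‖) := by
  set K : ℝ := lam + |C_b| + |C_c| + |C_s|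
  have hK : 0 ≤ K := by positivity
  have hA := stateAdjointConst_pos hK hc₀
  refine ⟨1 + stateAdjointConst K c₀ * (K * stateAdjointConst K c₀ / lam + 2), by positivity, ?_⟩
  intro b c s hb hcoer hc hs _ hpos F G f u y hF hG Hh Wh _ _ f_h u_h y_h hf_h hu_h hy_h hFh hGh
    ft hft ut hut yt hyt
  have hp : f_h - ft ∈ Hh := Hh.sub_mem hf_h hft
  have hq : u_h - ut ∈ Wh := Wh.sub_mem hu_h hut
  have hr : y_h - yt ∈ Wh := Wh.sub_mem hy_h hyt
  have horth₁ : ∀ g ∈ Hh, ∀ w ∈ Wh,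
      lam * ⟪f_h - ft, g⟫ + s (u_h - ut) w + b w (y_h - yt) - c g (y_h - yt) =
        lam * ⟪f - ft, g⟫ + s (u - ut) w + b w (y - yt) - c g (y - yt) := by
    intro g hg w hw
    have h₁ := hF g w
    have h₂ := hFh g hg w hw
    simp only [inner_sub_left, map_sub, LinearMap.sub_apply]
    linarith
  have horth₂ : ∀ v ∈ Wh,
      b (u_h - ut) v - c (f_h - ft) v = b (u - ut) v - c (f - ft) v := by
    intro v hv
    have h₁ := hG v
    have h₂ := hGh v hv
    simp only [map_sub, LinearMap.sub_apply]
    linarith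
  have htri_f : ‖f - f_h‖ ≤ ‖f - ft‖ + ‖f_h - ft‖ := by
    simpa using norm_sub_le (f - ft) (f_h - ft)
  have htri_u : ‖u - u_h‖ ≤ ‖u - ut‖ + ‖u_h - ut‖ := by
    simpa using norm_sub_le (u - ut) (u_h - ut)
  have htri_y : ‖y - y_h‖ ≤ ‖y - yt‖ + ‖y_h - yt‖ := by
    simpa using norm_sub_le (y - yt) (y_h - yt)
  generalize f_h - ft = p at *
  generalize u_h - ut = q at *
  generalize y_h - yt = r at *
  generalize f - ft = ef at *
  generalize u - ut = eu at *
  generalize y - yt = ey at *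
  have hC_b : |C_b| ≤ K := by linarith [abs_nonneg C_c, abs_nonneg C_s]
  have hC_c : |C_c| ≤ K := by linarith [abs_nonneg C_b, abs_nonneg C_s]
  have hC_s : |C_s| ≤ K := by linarith [abs_nonneg C_b, abs_nonneg C_c]
  have hlamK : lam ≤ K := by linarith [abs_nonneg C_b, abs_nonneg C_c, abs_nonneg C_s]
  have hbK (v w : W) : |b v w| ≤ K * ‖v‖ * ‖w‖ :=
    (hb v w).trans (by gcongr; exact (le_abs_self _).trans hC_b)
  have hcK (g : H) (w : W) : |c g w| ≤ K * ‖g‖ * ‖w‖ :=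
    (hc g w).trans (by gcongr; exact (le_abs_self _).trans hC_c)
  have hsK (v w : W) : |s v w| ≤ K * ‖v‖ * ‖w‖ :=
    (hs v w).trans (by gcongr; exact (le_abs_self _).trans hC_s)
  have hinner (g g' : H) : lam * ⟪g, g'⟫ ≤ K * ‖g‖ * ‖g'‖ := by
    calc lam * ⟪g, g'⟫ ≤ lam * (‖g‖ * ‖g'‖) := by gcongr; exact real_inner_le_norm g g'
      _ ≤ K * (‖g‖ * ‖g'‖) := by gcongr
      _ = _ := by ring
  have hstate : c₀ * ‖q‖ ^ 2 ≤ K * (‖p‖ + (‖ef‖ + ‖eu‖ + ‖ey‖)) * ‖q‖ := by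
    have h := horth₂ q hq
    have : 0 ≤ K * ‖ey‖ * ‖q‖ := by positivity
    linarith [hcoer q, (abs_le.mp (hcK p q)).2, (abs_le.mp (hbK eu q)).2, (abs_le.mp (hcK ef q)).1]
  have hadj : c₀ * ‖r‖ ^ 2 ≤ K * ((‖ef‖ + ‖eu‖ + ‖ey‖) + ‖q‖) * ‖r‖ := by
    have h := horth₁ 0 Hh.zero_mem r hr
    simp only [inner_zero_right, map_zero, LinearMap.zero_apply, mul_zero, zero_add,
      sub_zero] at h
    have : 0 ≤ K * ‖ef‖ * ‖r‖ := by positivity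
    linarith [hcoer r, (abs_le.mp (hsK q r)).1, (abs_le.mp (hsK eu r)).2, (abs_le.mp (hbK r ey)).2]
  have henergy : lam * ‖p‖ ^ 2 ≤ K * (‖ef‖ + ‖eu‖ + ‖ey‖) * (‖p‖ + ‖q‖ + ‖r‖) := by
    have h₁ := horth₁ p hp q hq
    have h₂ := horth₂ r hr
    rw [real_inner_self_eq_norm_sq] at h₁
    have h₃ : 0 ≤ K * ‖ef‖ * ‖q‖ := by positivity
    have h₄ : 0 ≤ K * ‖eu‖ * ‖p‖ := by positivity
    have h₅ : 0 ≤ K * ‖ey‖ * ‖r‖ := by positivity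
    linarith [hpos q, hinner ef p, (abs_le.mp (hsK eu q)).2, (abs_le.mp (hbK q ey)).2,
      (abs_le.mp (hcK p ey)).1, (abs_le.mp (hbK eu r)).1, (abs_le.mp (hcK ef r)).2]
  have hstab := add_le_of_saddlePoint_bounds hlam hc₀ hK (by positivity) (norm_nonneg p)
    (norm_nonneg q) (norm_nonneg r) hstate hadj henergy
  linarith
end

section
/- Let d ≥ 1, let q₁, …, q_{d+1} be points of ℝ^d, and let t₀ < t₁ be real numbers. For 1 ≤ k ≤ d+1 set p'_k := (t₀, q_k) and p''_k := (t₁, q_k) in ℝ × ℝ^d, and define the simplices S_k := convexHull {p'_k, p'_{k+1}, …, p'_{d+1}, p''_1, p''_2, …, p''_k}. Then the union of S_1, …, S_{d+1} equals the prism [t₀,t₁] × convexHull {q₁, …, q_{d+1}}; equivalently, it equals the convex hull of all 2(d+1) points p'_1, …, p'_{d+1}, p''_1, …, p''_{d+1}. -/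
/-- A nonnegative finite sequence can be truncated at some index `k` so that its sum takes any
prescribed value between `0` and the full sum: terms before `k` are kept, terms after `k` are
dropped. -/
lemma exists_truncation_sum_eq {n : ℕ} (w : Fin (n + 1) → ℝ) (hw : ∀ j, 0 ≤ w j) (s : ℝ)
    (hs : 0 ≤ s) (hsw : s ≤ ∑ j, w j) :
    ∃ (k : Fin (n + 1)) (b : Fin (n + 1) → ℝ), (∀ j, 0 ≤ b j) ∧ (∀ j, b j ≤ w j) ∧
      ∑ j, b j = s ∧ (∀ j, k < j → b j = 0) ∧ ∀ j, j < k → b j = w j := by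
  induction n generalizing s with
  | zero =>
    replace hsw : s ≤ w 0 := by simpa using hsw
    refine ⟨0, fun _ => s, fun _ => hs, fun j => ?_, by simp, fun j hj => ?_, fun j hj => ?_⟩
    · rwa [show j = 0 by lia]
    · lia
    · lia
  | succ n ih =>
    rcases le_total s (w 0) with h | h
    · refine ⟨0, Fin.cons s fun _ => 0, ?_, ?_, ?_, ?_, ?_⟩
      · exact Fin.cases (by simpa using hs) (by simp)
      · exact Fin.cases (by simpa using h) (by simpa using fun j => hw _)
      · simp [Fin.sum_univ_succ]
      · exact Fin.cases (by simp) (by simp)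
      · simp
    · rw [Fin.sum_univ_succ] at hsw
      obtain ⟨k, b, hb, hbw, hsum, hgt, hlt⟩ := ih (fun j => w j.succ) (fun j => hw _) (s - w 0)
        (by linarith) (by linarith)
      refine ⟨k.succ, Fin.cons (w 0) b, ?_, ?_, ?_, ?_, ?_⟩
      · exact Fin.cases (by simpa using hw 0) (by simpa using hb)
      · exact Fin.cases (by simp) (by simpa using hbw)
      · rw [Fin.sum_univ_succ]
        simp [hsum]
      · exact Fin.cases (by simp) (by simpa using hgt)
      · exact Fin.cases (by simp) (by simpa using hlt)

/-- The simplices of the staircase splitting cover the prism over a convex hull. -/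
lemma prism_subset_iUnion_simplices {E : Type*} [AddCommGroup E] [Module ℝ E] {n : ℕ}
    (q : Fin (n + 1) → E) {t₀ t₁ : ℝ} (ht : t₀ < t₁) :
    Set.Icc t₀ t₁ ×ˢ convexHull ℝ (Set.range q) ⊆
      ⋃ k : Fin (n + 1), convexHull ℝ
        ((fun j => (t₀, q j)) '' {j | k ≤ j} ∪ (fun j => (t₁, q j)) '' {j | j ≤ k}) := by
  rintro ⟨t, x⟩ ⟨htt, hx⟩
  obtain ⟨s, r, hs, hr, hsr, rfl⟩ : t ∈ segment ℝ t₀ t₁ := by rwa [segment_eq_Icc ht.le]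
  obtain ⟨w, ⟨hw, hw1⟩, rfl⟩ : ∃ w ∈ stdSimplex ℝ (Fin (n + 1)), ∑ j, w j • q j = x := by
    rw [convexHull_range_eq_exists_affineCombination] at hx
    obtain ⟨u, w, hw, hw1, rfl⟩ := hx
    classical
    refine ⟨fun j => if j ∈ u then w j else 0, ⟨fun j => ?_, by simpa using hw1⟩, ?_⟩
    · dsimp only
      split_ifs with h
      exacts [hw j h, le_rfl]
    · simp [u.affineCombination_eq_linear_combination q w hw1, ite_smul]
  obtain ⟨k, b, hb, hbw, hsum, hgt, hlt⟩ :=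
    exists_truncation_sum_eq w hw r hr (by linarith)
  refine Set.mem_iUnion.2 ⟨k, ?_⟩
  set S := (fun j => (t₀, q j)) '' {j | k ≤ j} ∪ (fun j => (t₁, q j)) '' {j | j ≤ k}
  have hmem := (convex_convexHull ℝ S).finsum_mem
    (w := Sum.elim (fun j => w j - b j) b)
    (z := Sum.elim (fun j => (t₀, q j)) (fun j => (t₁, q j)))
    (by rintro (j | j)
        · exact sub_nonneg.2 (hbw j)
        · exact hb j)
    (by simp [finsum_eq_sum_of_fintype, hw1])
    (by rintro (j | j) hj
        · refine subset_convexHull ℝ S (Or.inl ⟨j, ?_, rfl⟩)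
          exact (not_lt.1 fun h => hj (by simp [hlt j h]) : k ≤ j)
        · refine subset_convexHull ℝ S (Or.inr ⟨j, ?_, rfl⟩)
          exact (not_lt.1 fun h => hj (by simp [hgt j h]) : j ≤ k))
  convert hmem using 1
  rw [finsum_eq_sum_of_fintype, Fintype.sum_sum_type]
  refine Prod.ext ?_ ?_
  · simp [Prod.fst_sum, ← Finset.sum_mul, hw1, hsum, ← hsr]
  · simp [Prod.snd_sum, ← Finset.sum_add_distrib, ← add_smul]

/-- Covering property of the simplicial splitting (3.3) of a space-time prism from the
paper: the `d+1` simplices `S_k = conv(p'_k, …, p'_{d+1}, p''_1, …, p''_k)`, where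
`p'_j = (t₀, q_j)` and `p''_j = (t₁, q_j)`, cover the prism
`[t₀,t₁] × conv{q₁, …, q_{d+1}}`, which also equals the convex hull of all `2(d+1)`
points `p'_1, …, p'_{d+1}, p''_1, …, p''_{d+1}`. -/
theorem prism_simplicial_splitting_cover
    (d : ℕ) (hd : 1 ≤ d) (q : Fin (d + 1) → (Fin d → ℝ)) (t₀ t₁ : ℝ) (ht : t₀ < t₁) :
    (⋃ k : Fin (d + 1),
        convexHull ℝ
          ((fun j : Fin (d + 1) => ((t₀ : ℝ), q j)) '' {j | k ≤ j} ∪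
            (fun j : Fin (d + 1) => ((t₁ : ℝ), q j)) '' {j | j ≤ k}))
      = Set.Icc t₀ t₁ ×ˢ convexHull ℝ (Set.range q) ∧
    (⋃ k : Fin (d + 1),
        convexHull ℝ
          ((fun j : Fin (d + 1) => ((t₀ : ℝ), q j)) '' {j | k ≤ j} ∪
            (fun j : Fin (d + 1) => ((t₁ : ℝ), q j)) '' {j | j ≤ k}))
      = convexHull ℝ
          (Set.range (fun j : Fin (d + 1) => ((t₀ : ℝ), q j)) ∪
            Set.range (fun j : Fin (d + 1) => ((t₁ : ℝ), q j))) := by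
  have hcover := prism_subset_iUnion_simplices q ht
  have hsimplices : (⋃ k : Fin (d + 1), convexHull ℝ
      ((fun j => (t₀, q j)) '' {j | k ≤ j} ∪ (fun j => (t₁, q j)) '' {j | j ≤ k})) ⊆
      convexHull ℝ (Set.range (fun j => (t₀, q j)) ∪ Set.range (fun j => (t₁, q j))) :=
    Set.iUnion_subset fun k => convexHull_mono
      (Set.union_subset_union (Set.image_subset_range _ _) (Set.image_subset_range _ _))
  have hprism : convexHull ℝ (Set.range (fun j => (t₀, q j)) ∪ Set.range (fun j => (t₁, q j))) ⊆
      Set.Icc t₀ t₁ ×ˢ convexHull ℝ (Set.range q) := by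
    refine convexHull_min ?_ ((convex_Icc t₀ t₁).prod (convex_convexHull ℝ _))
    rintro _ (⟨j, rfl⟩ | ⟨j, rfl⟩)
    · exact ⟨Set.left_mem_Icc.2 ht.le, subset_convexHull ℝ _ ⟨j, rfl⟩⟩
    · exact ⟨Set.right_mem_Icc.2 ht.le, subset_convexHull ℝ _ ⟨j, rfl⟩⟩
  exact ⟨(hsimplices.trans hprism).antisymm hcover, hsimplices.antisymm (hprism.trans hcover)⟩
end
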